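/- A pseudoknot cannot be contained in two different blocks of the dual graph: if two stems S_1 and S_2 of an RNA secondary structure intertwine (there exist base pairs (i,j) in S_1 and (l,m) in S_2 with i < l < j < m), then the vertices corresponding to S_1 and S_2 belong to the same block (maximal non-separable subgraph) of the dual graph of the structure. -/

import Mathlib

/-! ## Multigraphs, subgraphs, blocks, degrees, connectivity -/

/-- A multigraph on vertex type `V` with edge type `E`: each edge is assigned an
unordered pair of endpoints. -/
structure Multigraph (V E : Type) where
  ends : E → Sym2 V

namespace Multigraph

variable {V E : Type}

/-- The degree of a vertex `u`: the number of edges incident at `u`. -/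
noncomputable def degree (G : Multigraph V E) (u : V) : ℕ :=
  Set.ncard {e | u ∈ G.ends e}

/-- A subgraph of a multigraph: a set of vertices together with a set of edges
all of whose endpoints lie in the vertex set. -/
structure Subgraph (G : Multigraph V E) where
  verts : Set V
  edges : Set E
  ends_mem : ∀ e ∈ edges, ∀ v, v ∈ G.ends e → v ∈ verts

namespace Subgraph

variable {G : Multigraph V E}

/-- The degree of a vertex `u` in a subgraph `H`: the number of edges of `H`
incident at `u`. -/
noncomputable def degree (H : G.Subgraph) (u : V) : ℕ :=
  Set.ncard {e ∈ H.edges | u ∈ G.ends e}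

/-- One step along an edge of the subgraph `H`, avoiding the deleted edges `F`
and the deleted vertices `W`. -/
def Adj (H : G.Subgraph) (F : Set E) (W : Set V) (a b : V) : Prop :=
  a ∈ H.verts ∧ b ∈ H.verts ∧ a ∉ W ∧ b ∉ W ∧
    ∃ e ∈ H.edges, e ∉ F ∧ G.ends e = s(a, b)

/-- The subgraph `H` is connected after deleting the edges in `F` and the
vertices in `W`: any two remaining vertices are joined by a walk. -/
def ConnectedAvoiding (H : G.Subgraph) (F : Set E) (W : Set V) : Prop :=
  ∀ u ∈ H.verts \ W, ∀ v ∈ H.verts \ W, Relation.ReflTransGen (H.Adj F W) u v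

/-- The subgraph `H` is connected (and nonempty). -/
def Connected (H : G.Subgraph) : Prop :=
  H.verts.Nonempty ∧ H.ConnectedAvoiding ∅ ∅

/-- `w` is an articulation point of `H`: deleting `w` disconnects `H`. -/
def IsArticulation (H : G.Subgraph) (w : V) : Prop :=
  w ∈ H.verts ∧ ¬ H.ConnectedAvoiding ∅ {w}

/-- A block of `G`: a maximal connected subgraph without articulation points
(maximal non-separable component). -/
def IsBlock (H : G.Subgraph) : Prop :=
  H.Connected ∧ (∀ w, ¬ H.IsArticulation w) ∧
    ∀ H' : G.Subgraph, H'.Connected → (∀ w, ¬ H'.IsArticulation w) →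
      H.verts ⊆ H'.verts → H.edges ⊆ H'.edges →
      H.verts = H'.verts ∧ H.edges = H'.edges

/-- The subgraph `H` has edge-connectivity exactly `2`: it is connected, it
remains connected after deleting any single edge, but some two edges
disconnect it. -/
def EdgeConnTwo (H : G.Subgraph) : Prop :=
  H.Connected ∧ (∀ e : E, H.ConnectedAvoiding {e} ∅) ∧
    ∃ e₁ ∈ H.edges, ∃ e₂ ∈ H.edges, e₁ ≠ e₂ ∧ ¬ H.ConnectedAvoiding {e₁, e₂} ∅

/-- `H` consists of a single edge together with its endpoints. -/
def IsSingleEdge (H : G.Subgraph) : Prop :=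
  ∃ e, H.edges = {e} ∧ H.verts = {v | v ∈ G.ends e}

/-- `H` is a cycle: a connected graph in which every vertex has degree
exactly `2`. -/
def IsCycle (H : G.Subgraph) : Prop :=
  H.Connected ∧ ∀ v ∈ H.verts, H.degree v = 2

end Subgraph

end Multigraph

/-! ## RNA secondary structures, stems, segments and the dual (di)graph -/

/-- An RNA secondary structure of length `n`: a set `pairs` of base pairs
`(i, j)` with `1 ≤ i < j ≤ n` in which every position occurs in at most one
base pair (a partial matching). -/
structure RNA (n : ℕ) where
  pairs : Finset (ℕ × ℕ)
  one_le : ∀ p ∈ pairs, 1 ≤ p.1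
  fst_lt_snd : ∀ p ∈ pairs, p.1 < p.2
  le_length : ∀ p ∈ pairs, p.2 ≤ n
  matching : ∀ p ∈ pairs, ∀ q ∈ pairs, p ≠ q →
    p.1 ≠ q.1 ∧ p.1 ≠ q.2 ∧ p.2 ≠ q.1 ∧ p.2 ≠ q.2

namespace RNA

variable {n : ℕ}

/-- Position `p` is paired (belongs to some base pair). -/
def Paired (R : RNA n) (p : ℕ) : Prop :=
  ∃ q, (p, q) ∈ R.pairs ∨ (q, p) ∈ R.pairs

/-- A stem of `R`: a maximal tuple of consecutively nested base pairs
`(i, j), (i+1, j-1), …, (i+r, j-r)` of `R`. -/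
structure Stem (R : RNA n) where
  i : ℕ
  j : ℕ
  r : ℕ
  nested : ∀ k ≤ r, (i + k, j - k) ∈ R.pairs
  sep : i + r < j - r
  max_out : (i - 1, j + 1) ∉ R.pairs
  max_in : (i + r + 1, j - (r + 1)) ∉ R.pairs

/-- Position `p` is occupied by the stem `S`. -/
def Stem.MemPos {R : RNA n} (S : Stem R) (p : ℕ) : Prop :=
  ∃ k ≤ S.r, p = S.i + k ∨ p = S.j - k

/-- `(a, b)` is one of the base pairs of the stem `S`. -/
def Stem.MemPair {R : RNA n} (S : Stem R) (a b : ℕ) : Prop :=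
  ∃ k ≤ S.r, a = S.i + k ∧ b = S.j - k

/-- `S` is a super-stem of `T` (written `S > T` in the paper): the region
occupied by `T` is strictly contained inside the paired region of `S`. -/
def SuperStem {R : RNA n} (S T : Stem R) : Prop :=
  S.i + S.r < T.i ∧ T.j < S.j - S.r

/-- A single-stranded segment running, 5' to 3', from the paired position `p`
to the next paired position `q`: all strictly intermediate positions are
unpaired. -/
def IsSegment (R : RNA n) (p q : ℕ) : Prop :=
  p < q ∧ R.Paired p ∧ R.Paired q ∧ ∀ t, p < t → t < q → ¬ R.Paired t

/-- An edge of the dual (di)graph of `R`: a single-stranded segment running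
from an occurrence (position `p`) of stem `src` to an occurrence (position
`q`) of stem `tgt`, with self-loops (hairpins, `src = tgt`) deleted.  Read as
a directed edge it is directed from `src` to `tgt` (5' to 3'). -/
structure DualEdge (R : RNA n) where
  p : ℕ
  q : ℕ
  src : Stem R
  tgt : Stem R
  seg : R.IsSegment p q
  mem_src : src.MemPos p
  mem_tgt : tgt.MemPos q
  ne : src ≠ tgt

/-- The dual graph of `R`: vertices are the stems of `R`, and each
single-stranded segment between occurrences of two distinct stems contributes
one edge between them. -/
def dualGraph (R : RNA n) : Multigraph (Stem R) (DualEdge R) :=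
  ⟨fun e => s(e.src, e.tgt)⟩

/-- The weight of a directed edge of the dual digraph: the order (1st, 2nd, …)
in which the corresponding segment is reached along the primary sequence,
i.e. the number of segments starting no later than it. -/
noncomputable def DualEdge.weight {R : RNA n} (e : DualEdge R) : ℕ :=
  Set.ncard {p' | ∃ q', R.IsSegment p' q' ∧ p' ≤ e.p}

end RNA

namespace Multigraph

variable {V E : Type}

/-- The underlying simple graph. -/
def toSimple (G : Multigraph V E) : SimpleGraph V where
  Adj u v := u ≠ v ∧ ∃ e, G.ends e = s(u, v)
  symm := ⟨by
    rintro u v ⟨h, e, he⟩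
    exact ⟨h.symm, e, by rw [he, Sym2.eq_swap]⟩⟩
  loopless := ⟨fun u h => h.1 rfl⟩

/-- Not separated by any set of at most one other vertex. -/
def Insep (G : Multigraph V E) (x y : V) : Prop :=
  ∀ W : Set V, W.Subsingleton → x ∉ W → y ∉ W →
    ∃ p : G.toSimple.Walk x y, ∀ z ∈ p.support, z ∉ W

theorem Insep.symm {G : Multigraph V E} {x y : V} (h : G.Insep x y) : G.Insep y x := by
  intro W hW hy hx
  obtain ⟨p, hp⟩ := h W hW hx hy
  exact ⟨p.reverse, by simpa using hp⟩

theorem walk_of_rel {G : Multigraph V E} (H : G.Subgraph) (W : Set V) {x y : V} (hx : x ∉ W)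
    (h : Relation.ReflTransGen (H.Adj ∅ W) x y) :
    ∃ p : G.toSimple.Walk x y, ∀ z ∈ p.support, z ∉ W := by
  induction h with
  | refl => exact ⟨.nil, by simpa using hx⟩
  | @tail b c hb hc ih =>
    obtain ⟨p, hp⟩ := ih
    obtain ⟨_, _, _, hcW, e, _, _, he⟩ := hc
    by_cases hbc : b = c
    · subst hbc; exact ⟨p, hp⟩
    · have hadj : G.toSimple.Adj b c := ⟨hbc, e, he⟩
      refine ⟨p.concat hadj, ?_⟩
      intro z hz
      rw [SimpleGraph.Walk.support_concat] at hz
      simp only [List.concat_eq_append, List.mem_append, List.mem_singleton] at hz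
      rcases hz with hz | rfl
      · exact hp z hz
      · exact hcW

/-- Induced subgraph. -/
def ind (G : Multigraph V E) (X : Set V) : G.Subgraph where
  verts := X
  edges := {e | ∀ v, v ∈ G.ends e → v ∈ X}
  ends_mem := fun _ he => he

theorem rel_of_walk {G : Multigraph V E} (X W : Set V) {x y : V} (p : G.toSimple.Walk x y)
    (h : ∀ z ∈ p.support, z ∈ X ∧ z ∉ W) :
    Relation.ReflTransGen ((G.ind X).Adj ∅ W) x y := by
  induction p with
  | nil => exact .refl
  | @cons a b c hadj p ih =>
    have ha := h a (by simp)
    have hb := h b (by simp)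
    refine Relation.ReflTransGen.head ?_ (ih fun z hz => h z (by simp [hz]))
    obtain ⟨_, e, he⟩ := hadj
    refine ⟨ha.1, hb.1, ha.2, hb.2, e, ?_, by simp, he⟩
    intro v hv
    rw [he, Sym2.mem_iff] at hv
    rcases hv with rfl | rfl
    · exact ha.1
    · exact hb.1

theorem path_mem {G : Multigraph V E} {X : Set V} (hX : X.Pairwise G.Insep)
    (hmax : ∀ z, (∀ x ∈ X, x ≠ z → G.Insep x z) → z ∈ X)
    {x y : V} (hx : x ∈ X) (hy : y ∈ X) (p : G.toSimple.Walk x y) (hp : p.IsPath)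
    {z : V} (hz : z ∈ p.support) : z ∈ X := by
  classical
  refine hmax z fun x' hx' hne W hW hxW hzW => ?_
  -- it suffices to reach some vertex of X off W
  have key : ∀ u ∈ X, (∃ q : G.toSimple.Walk u z, ∀ t ∈ q.support, t ∉ W) →
      ∃ q : G.toSimple.Walk x' z, ∀ t ∈ q.support, t ∉ W := by
    rintro u hu ⟨q, hq⟩
    by_cases hxu : x' = u
    · subst hxu; exact ⟨q, hq⟩
    · obtain ⟨r, hr⟩ := hX hx' hu hxu W hW hxW (hq u (by simp))
      refine ⟨r.append q, fun t ht => ?_⟩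
      rcases (SimpleGraph.Walk.mem_support_append_iff _ _).1 ht with ht | ht
      · exact hr t ht
      · exact hq t ht
  by_cases h1 : ∀ t ∈ (p.takeUntil z hz).support, t ∉ W
  · exact key x hx ⟨_, h1⟩
  by_cases h2 : ∀ t ∈ (p.dropUntil z hz).support, t ∉ W
  · exact key y hy ⟨(p.dropUntil z hz).reverse, by simpa using h2⟩
  exfalso
  push Not at h1 h2
  obtain ⟨t, ht, htW⟩ := h1
  obtain ⟨s, hs, hsW⟩ := h2
  obtain rfl := hW htW hsW
  have hnd := hp.support_nodup
  rw [← p.take_spec hz, SimpleGraph.Walk.support_append, List.nodup_append] at hnd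
  rw [SimpleGraph.Walk.mem_support_iff] at hs
  rcases hs with rfl | hs
  · exact hzW htW
  · exact hnd.2.2 _ ht _ hs rfl

theorem exists_block {G : Multigraph V E} {x y : V} (h : G.Insep x y) :
    ∃ B : G.Subgraph, B.IsBlock ∧ x ∈ B.verts ∧ y ∈ B.verts := by
  classical
  obtain ⟨X, hXsub, hXmax⟩ := zorn_subset_nonempty {X : Set V | X.Pairwise G.Insep} (by
    intro c hc hch _
    refine ⟨⋃₀ c, ?_, fun s hs => Set.subset_sUnion_of_mem hs⟩
    exact (Set.pairwise_sUnion hch.directedOn).2 fun s hs => hc hs) {x, y} (by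
      intro a ha b hb hab
      rcases ha with rfl | rfl <;> rcases hb with rfl | rfl
      · exact absurd rfl hab
      · exact h
      · exact h.symm
      · exact absurd rfl hab)
  have hX : X.Pairwise G.Insep := hXmax.prop
  have hmax : ∀ z, (∀ x ∈ X, x ≠ z → G.Insep x z) → z ∈ X := by
    intro z hz
    have : (insert z X).Pairwise G.Insep := by
      refine (Set.pairwise_insert).2 ⟨hX, fun b hb hne => ?_⟩
      exact ⟨(hz b hb hne.symm).symm, hz b hb hne.symm⟩
    exact hXmax.le_of_ge this (Set.subset_insert z X) (Set.mem_insert z X)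
  have hcon : ∀ W : Set V, W.Subsingleton → (G.ind X).ConnectedAvoiding ∅ W := by
    rintro W hW u ⟨hu, huW⟩ v ⟨hv, hvW⟩
    by_cases huv : u = v
    · subst huv; exact .refl
    obtain ⟨p, hp⟩ := hX hu hv huv W hW huW hvW
    refine rel_of_walk X W p.bypass fun z hz => ⟨?_, hp z (p.support_bypass_subset hz)⟩
    exact path_mem hX hmax hu hv p.bypass p.bypass_isPath hz
  refine ⟨G.ind X, ⟨⟨⟨x, hXsub (by simp)⟩, hcon ∅ (by simp)⟩, ?_, ?_⟩,
    hXsub (by simp), hXsub (by simp)⟩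
  · rintro w ⟨_, hw⟩
    exact hw (hcon {w} (by simp))
  · intro H' hH' hart hv he
    have hpw : H'.verts.Pairwise G.Insep := by
      intro u hu v hv' _ W hW huW hvW
      refine walk_of_rel H' W huW ?_
      rcases hW.eq_empty_or_singleton with rfl | ⟨w, rfl⟩
      · exact hH'.2 u ⟨hu, huW⟩ v ⟨hv', hvW⟩
      · by_cases hw : w ∈ H'.verts
        · have := hart w
          unfold Subgraph.IsArticulation at this
          push Not at this
          exact this hw u ⟨hu, huW⟩ v ⟨hv', hvW⟩
        · refine Relation.ReflTransGen.mono ?_ _ _ (hH'.2 u ⟨hu, by simp⟩ v ⟨hv', by simp⟩)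
          rintro a b ⟨ha, hb, _, _, hab⟩
          refine ⟨ha, hb, ?_, ?_, hab⟩
          · rintro rfl; exact hw ha
          · rintro rfl; exact hw hb
    have hEq : X = H'.verts := Set.Subset.antisymm hv (hXmax.le_of_ge hpw hv)
    refine ⟨hEq, Set.Subset.antisymm he fun e hee v hve => ?_⟩
    rw [hEq]
    exact H'.ends_mem e hee v hve

end Multigraph

namespace RNA

variable {n : ℕ} {R : RNA n}

theorem Stem.memPos_iff (S : Stem R) (p : ℕ) :
    S.MemPos p ↔ (S.i ≤ p ∧ p ≤ S.i + S.r) ∨ (S.j - S.r ≤ p ∧ p ≤ S.j) := by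
  have := S.sep
  constructor
  · rintro ⟨k, hk, h | h⟩ <;> omega
  · rintro (h | h)
    · exact ⟨p - S.i, by omega, by omega⟩
    · exact ⟨S.j - p, by omega, by omega⟩

theorem pair_unique {x y x' y' p : ℕ} (h : (x, y) ∈ R.pairs) (h' : (x', y') ∈ R.pairs)
    (hp : p = x ∨ p = y) (hp' : p = x' ∨ p = y') : x = x' ∧ y = y' := by
  by_contra hne
  have := R.matching _ h _ h' (by simpa using hne)
  simp only at this
  omega

theorem Stem.out_le {S T : Stem R} {k l : ℕ} (hk : k ≤ S.r) (hl : l ≤ T.r)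
    (h1 : S.i + k = T.i + l) (h2 : S.j - k = T.j - l) : l ≤ k := by
  by_contra hlt
  have h := T.nested (l - k - 1) (by omega)
  have e1 : T.i + (l - k - 1) = S.i - 1 := by omega
  have hs := S.sep
  have ht := T.sep
  have e2 : T.j - (l - k - 1) = S.j + 1 := by omega
  rw [e1, e2] at h
  exact S.max_out h

theorem Stem.r_le {S T : Stem R} (h1 : S.i = T.i) (h2 : S.j = T.j) : T.r ≤ S.r := by
  by_contra hlt
  have h := T.nested (S.r + 1) (by omega)
  rw [← h1, ← h2, ← add_assoc] at h
  exact S.max_in h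

theorem Stem.eq_of_memPos {S T : Stem R} {p : ℕ} (hS : S.MemPos p) (hT : T.MemPos p) :
    S = T := by
  obtain ⟨k, hk, hpk⟩ := hS
  obtain ⟨l, hl, hpl⟩ := hT
  obtain ⟨h1, h2⟩ := pair_unique (S.nested k hk) (T.nested l hl) hpk hpl
  have a1 := Stem.out_le hk hl h1 h2
  have a2 := Stem.out_le hl hk h1.symm h2.symm
  have s1 := S.sep
  have s2 := T.sep
  have e1 : S.i = T.i := by omega
  have e2 : S.j = T.j := by omega
  have e3 : S.r = T.r := le_antisymm (Stem.r_le e1.symm e2.symm) (Stem.r_le e1 e2)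
  cases S
  cases T
  simp only at e1 e2 e3
  subst e1 e2 e3
  rfl

theorem exists_stem_pair {x y : ℕ} (h : (x, y) ∈ R.pairs) : ∃ S : Stem R, S.MemPair x y := by
  classical
  have hxy := R.fst_lt_snd _ h
  have hx1 := R.one_le _ h
  have exo : ∃ m, (x - (m + 1), y + (m + 1)) ∉ R.pairs := by
    refine ⟨n, fun hh => ?_⟩
    have := R.le_length _ hh
    simp only at this
    omega
  have exi : ∃ m, (x + m + 1, y - (m + 1)) ∉ R.pairs := by
    refine ⟨n, fun hh => ?_⟩
    have := R.le_length _ hh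
    have := R.fst_lt_snd _ hh
    simp only at *
    omega
  obtain ⟨m, hm, hmin⟩ : ∃ m, (x - (m + 1), y + (m + 1)) ∉ R.pairs ∧
      ∀ k ≤ m, (x - k, y + k) ∈ R.pairs := by
    refine ⟨Nat.find exo, Nat.find_spec exo, fun k hk => ?_⟩
    rcases k with _ | k
    · simpa using h
    · exact not_not.1 (Nat.find_min exo (m := k) (by omega))
  obtain ⟨m', hm', hmin'⟩ : ∃ m, (x + m + 1, y - (m + 1)) ∉ R.pairs ∧
      ∀ k ≤ m, (x + k, y - k) ∈ R.pairs := by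
    refine ⟨Nat.find exi, Nat.find_spec exi, fun k hk => ?_⟩
    rcases k with _ | k
    · simpa using h
    · exact not_not.1 (Nat.find_min exi (m := k) (by omega))
  have b1 := R.one_le _ (hmin m le_rfl)
  have b2 := R.fst_lt_snd _ (hmin' m' le_rfl)
  simp only at b1 b2 hxy hx1
  refine ⟨⟨x - m, y + m, m + m', ?_, by omega, ?_, ?_⟩, m, by simp, by simp; omega, by simp⟩
  · intro k hk
    rcases le_total k m with hkm | hkm
    · have := hmin (m - k) (by omega)
      convert this using 2 <;> omega
    · have := hmin' (k - m) (by omega)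
      convert this using 2 <;> omega
  · convert hm using 3 <;> omega
  · convert hm' using 3 <;> omega

theorem exists_stem {p : ℕ} (h : R.Paired p) : ∃ S : Stem R, S.MemPos p := by
  obtain ⟨q, h | h⟩ := h
  · obtain ⟨S, k, hk, h1, h2⟩ := exists_stem_pair h
    exact ⟨S, k, hk, Or.inl h1⟩
  · obtain ⟨S, k, hk, h1, h2⟩ := exists_stem_pair h
    exact ⟨S, k, hk, Or.inr h2⟩

theorem Stem.paired {S : Stem R} {p : ℕ} (h : S.MemPos p) : R.Paired p := by
  obtain ⟨k, hk, rfl | rfl⟩ := h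
  · exact ⟨_, Or.inl (S.nested k hk)⟩
  · exact ⟨_, Or.inr (S.nested k hk)⟩

theorem rel_of_gap (W : Set (Stem R)) (p : ℕ) (S : Stem R) (hS : S.MemPos p) (q : ℕ) :
    ∀ T : Stem R, p ≤ q → T.MemPos q → (∀ t, p ≤ t → t ≤ q → ∀ w ∈ W, ¬ w.MemPos t) →
    Relation.ReflTransGen ((R.dualGraph.ind Set.univ).Adj ∅ W) S T := by
  classical
  induction q using Nat.strong_induction_on with
  | _ q ih =>
  intro T hpq hT hW
  rcases hpq.eq_or_lt with rfl | hlt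
  · rw [Stem.eq_of_memPos hS hT]
  have hP : ∃ t, t < q ∧ R.Paired t := ⟨p, hlt, Stem.paired hS⟩
  obtain ⟨t, ⟨htq, htP⟩, hpt, htmax⟩ : ∃ t, (t < q ∧ R.Paired t) ∧ p ≤ t ∧
      ∀ s, t < s → s < q → ¬ R.Paired s := by
    refine ⟨Nat.findGreatest (fun t => t < q ∧ R.Paired t) q, ?_, ?_, ?_⟩
    · exact Nat.findGreatest_spec (P := fun t => t < q ∧ R.Paired t) hpq
        ⟨hlt, Stem.paired hS⟩
    · exact Nat.le_findGreatest hpq ⟨hlt, Stem.paired hS⟩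
    · intro s hs hsq hsP
      exact Nat.findGreatest_is_greatest hs hsq.le ⟨hsq, hsP⟩
  obtain ⟨U, hU⟩ := exists_stem htP
  have h1 := ih t htq U hpt hU fun s hs hs' => hW s hs (by omega)
  by_cases hUT : U = T
  · rwa [← hUT]
  refine h1.tail ⟨trivial, trivial, fun hw => hW t hpt htq.le U hw hU,
    fun hw => hW q hpq le_rfl T hw hT,
    ⟨t, q, U, T, ⟨htq, htP, Stem.paired hT, htmax⟩, hU, hT, hUT⟩, ?_, by simp, rfl⟩
  intro v _
  trivial

theorem insep_of_intertwine (S₁ S₂ : Stem R) {a b c d : ℕ} (ha : S₁.MemPos a)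
    (hb : S₁.MemPos b) (hc : S₂.MemPos c) (hd : S₂.MemPos d)
    (h1 : a < c) (h2 : c < b) (h3 : b < d) : R.dualGraph.Insep S₁ S₂ := by
  intro W hW hS1 hS2
  by_cases g1 : ∀ t, a ≤ t → t ≤ c → ∀ w ∈ W, ¬ w.MemPos t
  · exact Multigraph.walk_of_rel _ W hS1 (rel_of_gap W a S₁ ha c S₂ h1.le hc g1)
  by_cases g3 : ∀ t, b ≤ t → t ≤ d → ∀ w ∈ W, ¬ w.MemPos t
  · exact Multigraph.walk_of_rel _ W hS1 (rel_of_gap W b S₁ hb d S₂ h3.le hd g3)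
  by_cases g2 : ∀ t, c ≤ t → t ≤ b → ∀ w ∈ W, ¬ w.MemPos t
  · obtain ⟨p, hp⟩ :=
      Multigraph.walk_of_rel _ W hS2 (rel_of_gap W c S₂ hc b S₁ h2.le hb g2)
    exact ⟨p.reverse, by simpa using hp⟩
  exfalso
  push Not at g1 g2 g3
  obtain ⟨t1, _, _, w, hw, m1⟩ := g1
  obtain ⟨t2, _, _, w2, hw2, m2⟩ := g2
  obtain ⟨t3, _, _, w3, hw3, m3⟩ := g3
  obtain rfl := hW hw hw2
  obtain rfl := hW hw hw3
  have nb : ¬ w.MemPos b := fun h => hS1 (Stem.eq_of_memPos h hb ▸ hw)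
  have nc : ¬ w.MemPos c := fun h => hS2 (Stem.eq_of_memPos h hc ▸ hw)
  rw [Stem.memPos_iff] at m1 m2 m3 nb nc
  have := w.sep
  omega

end RNA

/-- A pseudoknot cannot be contained in two different blocks:
if two stems `S₁` and `S₂` of an RNA secondary structure intertwine (some
base pair `(a, b)` of `S₁` and `(c, d)` of `S₂` satisfy `a < c < b < d`),
then the corresponding vertices lie in a common block of the dual graph. -/
theorem intertwined_stems_in_same_block {n : ℕ} (R : RNA n)
    (S₁ S₂ : RNA.Stem R)
    (hint : ∃ a b c d : ℕ, S₁.MemPair a b ∧ S₂.MemPair c d ∧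
      a < c ∧ c < b ∧ b < d) :
    ∃ B : Multigraph.Subgraph R.dualGraph,
      B.IsBlock ∧ S₁ ∈ B.verts ∧ S₂ ∈ B.verts := by
  obtain ⟨a, b, c, d, ⟨k, hk, ha, hb⟩, ⟨l, hl, hc, hd⟩, h1, h2, h3⟩ := hint
  exact Multigraph.exists_block (RNA.insep_of_intertwine S₁ S₂ ⟨k, hk, Or.inl ha⟩
    ⟨k, hk, Or.inr hb⟩ ⟨l, hl, Or.inl hc⟩ ⟨l, hl, Or.inr hd⟩ h1 h2 h3)
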